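/- arXiv:2503.22644 — 3 statements merged into one kernel-verified Lean document; each statement's English description precedes it below -/
import Mathlib

section
/- Let Λ be a generalized spectrum with λ_2 > 0. Then for every natural number k, F^(k)(Λ) ⪰ F^(k)(S(Λ)), where F^(k) denotes the k-fold iterate of F. -/
noncomputable section

/-!
A generalized spectrum `Λ = (q, λ)` is represented by a pair of functions
`q lam : ℕ → ℝ` (zero-indexed, so `lam 0` is `λ₁`), padded with zeros beyond
the (finite) length of the vectors.
-/

/-- `(q, lam)` is a generalized spectrum: `q₁ = 1`, `q ≥ 0`, `λ₁ > λ₂ ≥ λ₃ ≥ ⋯ ≥ 0`,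
both vectors have finite length (zero padding), and `Σᵢ qᵢ λᵢ = 1`. -/
def IsGenSpec (q lam : ℕ → ℝ) : Prop :=
  q 0 = 1 ∧ (∀ i, 0 ≤ q i) ∧
  lam 1 < lam 0 ∧ (∀ i, 1 ≤ i → lam (i + 1) ≤ lam i) ∧ (∀ i, 0 ≤ lam i) ∧
  (∃ N, ∀ i, N ≤ i → q i = 0 ∧ lam i = 0) ∧
  ∑' i, q i * lam i = 1

/-- λ-component of `F(Λ)`: `μᵢ = (λᵢ + λᵢ²)/(1 + Σⱼ qⱼ λⱼ²)`;
the q-component of `F(Λ)` is unchanged. -/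
def Fspec (q lam : ℕ → ℝ) : ℕ → ℝ :=
  fun i => (lam i + lam i ^ 2) / (1 + ∑' j, q j * lam j ^ 2)

/-- q-component of `S(Λ) = ((1, (1-λ₁)/λ₂), (λ₁, λ₂))`. -/
def Sq (lam : ℕ → ℝ) : ℕ → ℝ :=
  fun i => if i = 0 then 1 else if i = 1 then (1 - lam 0) / lam 1 else 0

/-- λ-component of `S(Λ) = ((1, (1-λ₁)/λ₂), (λ₁, λ₂))`. -/
def Slam (lam : ℕ → ℝ) : ℕ → ℝ :=
  fun i => if i ≤ 1 then lam i else 0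

/-- `Λ ⪰ Λ'` iff `λ₁(Λ) ≥ λ₁(Λ')` and `Δ(Λ) ≥ Δ(Λ')`, where `Δ = λ₁ - λ₂`.
This depends only on the λ-components. -/
def Succeq (lam lam' : ℕ → ℝ) : Prop :=
  lam' 0 ≤ lam 0 ∧ lam' 0 - lam' 1 ≤ lam 0 - lam 1

/-- Membership in `𝒮`: the vectors have length 2. -/
def HasLen2 (q lam : ℕ → ℝ) : Prop := ∀ i, 2 ≤ i → q i = 0 ∧ lam i = 0

/-- Weighted sums over a generalized spectrum have finite support, hence converge. -/
theorem IsGenSpec.summable_mul {q lam : ℕ → ℝ} (h : IsGenSpec q lam) (f : ℕ → ℝ) :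
    Summable fun i => q i * f i := by
  obtain ⟨-, -, -, -, -, ⟨N, hN⟩, -⟩ := h
  refine summable_of_ne_finset_zero (s := Finset.range N) fun i hi => ?_
  rw [(hN i (by simpa using hi)).1, zero_mul]

theorem IsGenSpec.tsum_tail {q lam : ℕ → ℝ} (h : IsGenSpec q lam) :
    ∑' i, q (i + 1) * lam (i + 1) = 1 - lam 0 := by
  have hs := (h.summable_mul lam).tsum_eq_zero_add
  rw [h.2.2.2.2.2.2, h.1] at hs
  linarith

theorem IsGenSpec.le_one {q lam : ℕ → ℝ} (h : IsGenSpec q lam) : lam 0 ≤ 1 := by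
  have h0 : 0 ≤ ∑' i, q (i + 1) * lam (i + 1) :=
    tsum_nonneg fun i => mul_nonneg (h.2.1 _) (h.2.2.2.2.1 _)
  linarith [h.tsum_tail]

theorem IsGenSpec.le_lam_one {q lam : ℕ → ℝ} (h : IsGenSpec q lam) (i : ℕ) :
    lam (i + 1) ≤ lam 1 := by
  induction i with
  | zero => exact le_rfl
  | succ n ih => exact (h.2.2.2.1 (n + 1) (by omega)).trans ih

theorem IsGenSpec.tsum_sq_nonneg {q lam : ℕ → ℝ} (h : IsGenSpec q lam) :
    0 ≤ ∑' i, q i * lam i ^ 2 :=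
  tsum_nonneg fun _ => mul_nonneg (h.2.1 _) (sq_nonneg _)

theorem IsGenSpec.tsum_sq_le {q lam : ℕ → ℝ} (h : IsGenSpec q lam) :
    ∑' i, q i * lam i ^ 2 ≤ lam 0 ^ 2 + (1 - lam 0) * lam 1 := by
  rw [(h.summable_mul fun i => lam i ^ 2).tsum_eq_zero_add, h.1, one_mul, ← h.tsum_tail,
    ← tsum_mul_right]
  refine add_le_add le_rfl (Summable.tsum_le_tsum (fun i => ?_)
    ((summable_nat_add_iff 1).2 (h.summable_mul fun i => lam i ^ 2))
    (((summable_nat_add_iff 1).2 (h.summable_mul lam)).mul_right _))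
  rw [sq, ← mul_assoc]
  exact mul_le_mul_of_nonneg_left (h.le_lam_one i) (mul_nonneg (h.2.1 _) (h.2.2.2.2.1 _))

theorem IsGenSpec.tsum_sq_eq {q lam : ℕ → ℝ} (h : IsGenSpec q lam) (h2 : HasLen2 q lam) :
    ∑' i, q i * lam i ^ 2 = lam 0 ^ 2 + (1 - lam 0) * lam 1 := by
  rw [(h.summable_mul fun i => lam i ^ 2).tsum_eq_zero_add, h.1, one_mul, ← h.tsum_tail,
    ← tsum_mul_right]
  congr 2
  ext i
  rcases i with _ | i
  · ring
  · simp [(h2 (i + 1 + 1) (by omega)).1]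

theorem IsGenSpec.fspec {q lam : ℕ → ℝ} (h : IsGenSpec q lam) : IsGenSpec q (Fspec q lam) := by
  have hD : 0 < 1 + ∑' i, q i * lam i ^ 2 := by linarith [h.tsum_sq_nonneg]
  have hsum : ∑' i, q i * Fspec q lam i = 1 := by
    have e : ∀ i, q i * Fspec q lam i =
        (q i * lam i + q i * lam i ^ 2) / (1 + ∑' j, q j * lam j ^ 2) := fun i => by
      simp only [Fspec]; ring
    rw [tsum_congr e, tsum_div_const,
      (h.summable_mul lam).tsum_add (h.summable_mul fun i => lam i ^ 2), h.2.2.2.2.2.2,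
      div_self hD.ne']
  obtain ⟨h0, hq, h1, hm, hl, ⟨N, hN⟩, -⟩ := h
  refine ⟨h0, hq, ?_, fun i hi => ?_, fun i => ?_, ⟨N, fun i hi => ⟨(hN i hi).1, ?_⟩⟩, hsum⟩
  · have := hl 1
    simp only [Fspec]
    gcongr
  · have := hm i hi
    have := hl (i + 1)
    simp only [Fspec]
    gcongr
  · have := hl i
    simp only [Fspec]
    positivity
  · simp [Fspec, (hN i hi).2]

theorem HasLen2.fspec {q lam : ℕ → ℝ} (h : HasLen2 q lam) : HasLen2 q (Fspec q lam) :=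
  fun i hi => ⟨(h i hi).1, by simp [Fspec, (h i hi).2]⟩

theorem hasLen2_Sq_Slam (lam : ℕ → ℝ) : HasLen2 (Sq lam) (Slam lam) := fun i hi => by
  simp [Sq, Slam, show i ≠ 0 by omega, show i ≠ 1 by omega, show ¬ i ≤ 1 by omega]

theorem IsGenSpec.Sq_Slam {q lam : ℕ → ℝ} (h : IsGenSpec q lam) (hpos : 0 < lam 1) :
    IsGenSpec (Sq lam) (Slam lam) := by
  have hle := h.le_one
  obtain ⟨-, -, h1, -, hl, -, -⟩ := h
  refine ⟨by simp [Sq], fun i => ?_, by simpa [Slam] using h1, fun i hi => ?_, fun i => ?_,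
    ⟨2, hasLen2_Sq_Slam lam⟩, ?_⟩
  · unfold Sq
    split_ifs
    · exact zero_le_one
    · exact div_nonneg (by linarith) hpos.le
    · exact le_rfl
  · unfold Slam
    rw [if_neg (by omega)]
    split_ifs
    · exact hl i
    · exact le_rfl
  · unfold Slam
    split_ifs
    · exact hl i
    · exact le_rfl
  · rw [tsum_eq_sum (s := Finset.range 2) fun i hi => by
      rw [(hasLen2_Sq_Slam lam i (by simpa [Nat.succ_le_iff] using hi)).1, zero_mul]]
    simp [Finset.sum_range_succ, Sq, Slam, div_mul_cancel₀ _ hpos.ne']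

/-- The first entry after one step of `F` on a length-two spectrum, in terms of `λ₁` and the gap,
is monotone in both. -/
theorem first_entry_mono {a s c t : ℝ} (hs : s ≤ a) (ht0 : 0 < t) (ht : t ≤ c)
    (hca : c ≤ a) (hts : t ≤ s) (ha : a ≤ 1) :
    (c + c ^ 2) / (1 + c - t * (1 - c)) ≤ (a + a ^ 2) / (1 + a - s * (1 - a)) := by
  have hD : 0 < 1 + c - t * (1 - c) := by nlinarith
  have hE : 0 < 1 + a - s * (1 - a) := by nlinarith
  have hM : 0 < 1 + a - t * (1 - a) := by nlinarith
  trans (a + a ^ 2) / (1 + a - t * (1 - a))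
  · rw [div_le_div_iff₀ hD hM]
    have key : 0 ≤ (a - c) * ((1 - t) * (1 + a + c) + (1 + t) * (a * c)) :=
      mul_nonneg (by linarith) (add_nonneg (mul_nonneg (by linarith) (by linarith))
        (mul_nonneg (by linarith) (mul_nonneg (by linarith) (by linarith))))
    linear_combination key
  · have : 0 ≤ a := by linarith
    have : 0 ≤ 1 - a := by linarith
    gcongr

/-- The gap after one step of `F` on a length-two spectrum, in terms of `λ₁` and the gap,
is monotone in both. -/
theorem gap_mono {a s c t : ℝ} (hs : s ≤ a) (ht0 : 0 < t) (ht : t ≤ c)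
    (hca : c ≤ a) (hts : t ≤ s) (ha : a ≤ 1) :
    t * (1 + 2 * c - t) / (1 + c - t * (1 - c)) ≤
      s * (1 + 2 * a - s) / (1 + a - s * (1 - a)) := by
  have hD : 0 < 1 + c - t * (1 - c) := by nlinarith
  have hE : 0 < 1 + a - s * (1 - a) := by nlinarith
  have hM : 0 < 1 + a - t * (1 - a) := by nlinarith
  trans t * (1 + 2 * a - t) / (1 + a - t * (1 - a))
  · rw [div_le_div_iff₀ hD hM]
    have key : 0 ≤ t * ((a - c) * ((1 - t) * (1 - t))) :=
      mul_nonneg ht0.le (mul_nonneg (by linarith) (mul_self_nonneg _))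
    linear_combination key
  · have h1 : t * (1 + 2 * a - t) ≤ s * (1 + 2 * a - s) := by
      nlinarith [mul_nonneg (sub_nonneg.2 hts) (show 0 ≤ 1 + 2 * a - s - t by linarith)]
    have h2 : 0 ≤ s * (1 + 2 * a - s) := mul_nonneg (by linarith) (by linarith)
    have : 0 ≤ 1 - a := by linarith
    gcongr

/-- One step of `F` preserves domination of a length-two spectrum. -/
theorem Succeq.fspec {q lam p mu : ℕ → ℝ} (h : IsGenSpec q lam) (h' : IsGenSpec p mu)
    (h2 : HasLen2 p mu) (hle : Succeq lam mu) : Succeq (Fspec q lam) (Fspec p mu) := by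
  obtain ⟨hca, hts⟩ := hle
  have hb := h.2.2.2.2.1 1
  have hd := h'.2.2.2.2.1 1
  have hgap := h'.2.2.1
  have hgap' := h.2.2.1
  have ha := h.le_one
  have h0 := h.tsum_sq_nonneg
  have hD : 1 + ∑' i, q i * lam i ^ 2 ≤
      1 + lam 0 - (lam 0 - lam 1) * (1 - lam 0) := by
    linarith [h.tsum_sq_le]
  have hE : 1 + ∑' i, p i * mu i ^ 2 = 1 + mu 0 - (mu 0 - mu 1) * (1 - mu 0) := by
    rw [h'.tsum_sq_eq h2]; ring
  have hpos : 0 < 1 + ∑' i, q i * lam i ^ 2 := by linarith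
  constructor
  · simp only [Fspec, hE]
    refine (first_entry_mono (a := lam 0) (s := lam 0 - lam 1) (by linarith) (by linarith)
      (by linarith) hca hts ha).trans ?_
    have : 0 ≤ lam 0 := by linarith
    gcongr
  · simp only [Fspec, hE, ← sub_div]
    have e : ∀ x y : ℝ, x + x ^ 2 - (y + y ^ 2) = (x - y) * (1 + 2 * x - (x - y)) :=
      fun x y => by ring
    rw [e, e]
    refine (gap_mono (a := lam 0) (s := lam 0 - lam 1) (by linarith) (by linarith)
      (by linarith) hca hts ha).trans ?_
    have : 0 ≤ (lam 0 - lam 1) * (1 + 2 * lam 0 - (lam 0 - lam 1)) :=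
      mul_nonneg (by linarith) (by linarith)
    gcongr

/-- `F^(k)(Λ) ⪰ F^(k)(S(Λ))` for every `k`. Since `F` leaves the
q-component unchanged, the k-fold iterate of `F` acts on the λ-component as
`(Fspec q)^[k]`. -/
theorem stmt5 (q lam : ℕ → ℝ) (h : IsGenSpec q lam) (hpos : 0 < lam 1) (k : ℕ) :
    Succeq ((Fspec q)^[k] lam) ((Fspec (Sq lam))^[k] (Slam lam)) := by
  suffices H : IsGenSpec q ((Fspec q)^[k] lam) ∧
      IsGenSpec (Sq lam) ((Fspec (Sq lam))^[k] (Slam lam)) ∧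
      HasLen2 (Sq lam) ((Fspec (Sq lam))^[k] (Slam lam)) ∧
      Succeq ((Fspec q)^[k] lam) ((Fspec (Sq lam))^[k] (Slam lam)) from H.2.2.2
  induction k with
  | zero => exact ⟨h, h.Sq_Slam hpos, hasLen2_Sq_Slam lam, by simp [Succeq, Slam]⟩
  | succ n ih =>
    obtain ⟨i1, i2, i3, i4⟩ := ih
    simp only [Function.iterate_succ_apply']
    exact ⟨i1.fspec, i2.fspec, i3.fspec, i4.fspec i1 i2 i3⟩
end
end

section
/- Let d ≥ 2 and λ ∈ V, and set λ' = F(λ). Then E(λ') ≤ E(λ)·exp(−1/(E(λ) + 5/2)). -/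
open Finset

noncomputable section

/-- Membership in the set `V` of valid spectra (zero-indexed: `lam 0` is `λ₁`). -/
def memV {d : ℕ} [NeZero d] (lam : Fin d → ℝ) : Prop :=
  (∀ i, 0 ≤ lam i) ∧ (∀ i j : Fin d, i ≤ j → lam j ≤ lam i) ∧
    lam 1 < lam 0 ∧ ∑ i, lam i = 1

/-- The spectrum map induced by a successful swap test:
`F(λ)_i = λ_i(λ_i+1)/(1+‖λ‖²)`. -/
def Fmap {d : ℕ} (lam : Fin d → ℝ) : Fin d → ℝ :=
  fun i => lam i * (lam i + 1) / (1 + ∑ j, lam j ^ 2)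

/-- `E(λ) = Σ_{j=2}^d λ_j/(λ_1 - λ_j)`. -/
def Evec {d : ℕ} [NeZero d] (lam : Fin d → ℝ) : ℝ :=
  ∑ j ∈ Finset.univ.erase (0 : Fin d), lam j / (lam 0 - lam j)

/-- `η(λ) = 1 - λ₁`. -/
def etaV {d : ℕ} [NeZero d] (lam : Fin d → ℝ) : ℝ := 1 - lam 0

theorem sum_div_sub_weighted_le {ι : Type*} (s : Finset ι) (a : ℝ) (b : ι → ℝ) (ha : 0 < a)
    (hb : ∀ j ∈ s, 0 ≤ b j) (hba : ∀ j ∈ s, b j < a) (hsum : ∑ j ∈ s, b j = 1 - a) :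
    ∑ j ∈ s, b j / (a - b j) * ((1 + a + b j) / a) ≤
      (∑ j ∈ s, b j / (a - b j)) * (∑ j ∈ s, b j / (a - b j) + 5 / 2) := by
  set E := ∑ j ∈ s, b j / (a - b j) with hE
  have hw : ∀ j ∈ s, 0 ≤ b j / (a - b j) := fun j hj =>
    div_nonneg (hb j hj) (sub_nonneg.2 (hba j hj).le)
  have hE0 : 0 ≤ E := Finset.sum_nonneg hw
  set S := (1 - a) / a with hS
  have hSsum : ∑ j ∈ s, b j / a = S := by rw [← Finset.sum_div, hsum]
  have hSE : S ≤ E := by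
    rw [← hSsum]
    refine Finset.sum_le_sum fun j hj => ?_
    exact div_le_div_of_nonneg_left (hb j hj) (sub_pos.2 (hba j hj)) (by linarith [hb j hj])
  have hES : E ≤ S * (1 + E) := by
    rw [← hSsum, Finset.sum_mul, hE]
    refine Finset.sum_le_sum fun j hj => ?_
    have hpos : 0 < a - b j := sub_pos.2 (hba j hj)
    have hle : b j / (a - b j) ≤ E := Finset.single_le_sum hw hj
    calc b j / (a - b j) = b j / a * (1 + b j / (a - b j)) := by
          field_simp
          ring
      _ ≤ b j / a * (1 + E) := by
          have := div_nonneg (hb j hj) ha.le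
          gcongr
  have hexp : ∑ j ∈ s, b j / (a - b j) * ((1 + a + b j) / a) = (3 + S) * E - S := by
    have hterm : ∀ j ∈ s, b j / (a - b j) * ((1 + a + b j) / a) =
        (3 + S) * (b j / (a - b j)) - b j / a := by
      intro j hj
      have hne : a - b j ≠ 0 := (sub_pos.2 (hba j hj)).ne'
      rw [hS]
      field_simp
      ring
    rw [Finset.sum_congr rfl hterm, Finset.sum_sub_distrib, ← Finset.mul_sum, hSsum]
  rw [hexp]
  nlinarith [mul_nonneg hE0 (sub_nonneg.2 hSE), sq_nonneg E]

theorem sum_div_sub_mul_le {ι : Type*} (s : Finset ι) (a : ℝ) (b : ι → ℝ) (ha : 0 < a)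
    (hb : ∀ j ∈ s, 0 ≤ b j) (hba : ∀ j ∈ s, b j < a) (hsum : ∑ j ∈ s, b j = 1 - a) :
    ∑ j ∈ s, b j / (a - b j) * ((1 + b j) / (1 + a + b j)) ≤
      (∑ j ∈ s, b j / (a - b j)) * (1 - 1 / (∑ j ∈ s, b j / (a - b j) + 5 / 2)) := by
  have key := sum_div_sub_weighted_le s a b ha hb hba hsum
  set E := ∑ j ∈ s, b j / (a - b j) with hE
  have hw : ∀ j ∈ s, 0 ≤ b j / (a - b j) := fun j hj =>
    div_nonneg (hb j hj) (sub_nonneg.2 (hba j hj).le)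
  have hE0 : 0 ≤ E := Finset.sum_nonneg hw
  set m := E + 5 / 2 with hm
  have hm0 : 0 < m := by positivity
  -- The tangent line of `y ↦ y⁻¹` at `m` bounds each factor.
  have htangent : ∀ j ∈ s, (1 + b j) / (1 + a + b j) ≤ 1 - 2 / m + (1 + a + b j) / a / m ^ 2 := by
    intro j hj
    have hy : 0 < 1 + a + b j := by linarith [hb j hj]
    rw [← sub_nonneg]
    have : 1 - 2 / m + (1 + a + b j) / a / m ^ 2 - (1 + b j) / (1 + a + b j) =
        ((1 + a + b j) - a * m) ^ 2 / (a * m ^ 2 * (1 + a + b j)) := by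
      field_simp
      ring
    rw [this]
    positivity
  calc ∑ j ∈ s, b j / (a - b j) * ((1 + b j) / (1 + a + b j))
      ≤ ∑ j ∈ s, b j / (a - b j) * (1 - 2 / m + (1 + a + b j) / a / m ^ 2) :=
        Finset.sum_le_sum fun j hj => mul_le_mul_of_nonneg_left (htangent j hj) (hw j hj)
    _ = E * (1 - 2 / m) + (∑ j ∈ s, b j / (a - b j) * ((1 + a + b j) / a)) / m ^ 2 := by
        rw [hE, Finset.sum_mul, Finset.sum_div, ← Finset.sum_add_distrib]
        exact Finset.sum_congr rfl fun j _ => by ring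
    _ ≤ E * (1 - 2 / m) + E * m / m ^ 2 := by gcongr
    _ = E * (1 - 1 / m) := by
        field_simp
        ring

theorem memV.lt_zero {d : ℕ} [NeZero d] {lam : Fin d → ℝ} (hV : memV lam) {j : Fin d}
    (hj : j ≠ 0) : lam j < lam 0 := by
  refine (hV.2.1 1 j ?_).trans_lt hV.2.2.1
  have h0 : (j : ℕ) ≠ 0 := fun h => hj (Fin.ext (by simpa using h))
  rw [Fin.le_def, Fin.val_one']
  exact (Nat.mod_le 1 d).trans (Nat.one_le_iff_ne_zero.2 h0)

theorem Evec_Fmap {d : ℕ} [NeZero d] {lam : Fin d → ℝ} (hV : memV lam) :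
    Evec (Fmap lam) = ∑ j ∈ Finset.univ.erase (0 : Fin d),
      lam j / (lam 0 - lam j) * ((1 + lam j) / (1 + lam 0 + lam j)) := by
  refine Finset.sum_congr rfl fun j hj => ?_
  have hpos : 0 < lam 0 - lam j := sub_pos.2 (hV.lt_zero (Finset.ne_of_mem_erase hj))
  have hy : 0 < 1 + lam 0 + lam j := by linarith [hV.1 0, hV.1 j]
  have hN : (1 + ∑ i, lam i ^ 2) ≠ 0 := by positivity
  simp only [Fmap]
  rw [← sub_div, div_div_div_cancel_right₀ hN, div_mul_div_comm]
  congr 1 <;> ring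

/-- one-step decay of `E` in terms of `E` itself. -/
theorem stmt12 (d : ℕ) [NeZero d] (hd : 2 ≤ d) (lam : Fin d → ℝ) (hV : memV lam) :
    Evec (Fmap lam) ≤ Evec lam * Real.exp (-(1 / (Evec lam + 5/2))) := by
  have hpos : 0 < lam 0 := (hV.1 1).trans_lt hV.2.2.1
  have hsum : ∑ j ∈ Finset.univ.erase (0 : Fin d), lam j = 1 - lam 0 := by
    rw [← hV.2.2.2, ← Finset.add_sum_erase _ lam (Finset.mem_univ 0)]
    ring
  have hlt : ∀ j ∈ Finset.univ.erase (0 : Fin d), lam j < lam 0 := fun j hj =>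
    hV.lt_zero (Finset.ne_of_mem_erase hj)
  have hE0 : 0 ≤ Evec lam := Finset.sum_nonneg fun j hj =>
    div_nonneg (hV.1 j) (sub_nonneg.2 (hlt j hj).le)
  rw [Evec_Fmap hV]
  refine (sum_div_sub_mul_le _ (lam 0) lam hpos (fun j _ => hV.1 j) hlt hsum).trans ?_
  exact mul_le_mul_of_nonneg_left (Real.one_sub_le_exp_neg _) hE0
end
end

section
/- Let d ≥ 2 and λ ∈ V with E(λ) ≤ 1/2. Then for every natural number t, η(F^(t)(λ)) ≤ (e²/2^t)·E(λ). -/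
open Finset

noncomputable section

theorem one_add_sum_sq_pos {d : ℕ} (lam : Fin d → ℝ) : 0 < 1 + ∑ j, lam j ^ 2 := by
  positivity

/-- A probability vector whose leading entry is positive and strictly larger than all others. -/
structure IsDominated {d : ℕ} [NeZero d] (lam : Fin d → ℝ) : Prop where
  nonneg : ∀ i, 0 ≤ lam i
  pos : 0 < lam 0
  lt : ∀ j, j ≠ 0 → lam j < lam 0
  sum_eq : ∑ i, lam i = 1

theorem memV.isDominated {d : ℕ} [NeZero d] (hd : 2 ≤ d) {lam : Fin d → ℝ} (h : memV lam) :
    IsDominated lam := by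
  obtain ⟨h0, hmono, hlt, hsum⟩ := h
  refine ⟨h0, (h0 1).trans_lt hlt, fun j hj => (hmono 1 j ?_).trans_lt hlt, hsum⟩
  obtain ⟨n, rfl⟩ : ∃ n, d = n + 2 := ⟨d - 2, by omega⟩
  exact Fin.one_le_of_ne_zero hj

namespace IsDominated

variable {d : ℕ} [NeZero d] {lam : Fin d → ℝ}

theorem map (h : IsDominated lam) : IsDominated (Fmap lam) := by
  have hS := one_add_sum_sq_pos lam
  refine ⟨fun i => ?_, ?_, fun j hj => ?_, ?_⟩
  · have := h.nonneg i
    unfold Fmap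
    positivity
  · have := h.pos
    unfold Fmap
    positivity
  · refine div_lt_div_of_pos_right ?_ hS
    nlinarith [h.nonneg j, h.lt j hj, h.pos]
  · unfold Fmap
    simp only [mul_add, mul_one, ← pow_two]
    rw [← Finset.sum_div, Finset.sum_add_distrib, h.sum_eq, add_comm, div_self hS.ne']

theorem sum_erase (h : IsDominated lam) :
    ∑ j ∈ Finset.univ.erase (0 : Fin d), lam j = etaV lam := by
  have := Finset.add_sum_erase Finset.univ lam (Finset.mem_univ 0)
  rw [h.sum_eq] at this
  unfold etaV
  linarith

theorem etaV_nonneg (h : IsDominated lam) : 0 ≤ etaV lam :=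
  h.sum_erase ▸ Finset.sum_nonneg fun j _ => h.nonneg j

theorem le_etaV (h : IsDominated lam) {j : Fin d} (hj : j ≠ 0) : lam j ≤ etaV lam :=
  h.sum_erase ▸ Finset.single_le_sum (fun i _ => h.nonneg i)
    (Finset.mem_erase.2 ⟨hj, Finset.mem_univ j⟩)

theorem etaV_le_Evec (h : IsDominated lam) : etaV lam ≤ Evec lam := by
  rw [← h.sum_erase]
  refine Finset.sum_le_sum fun j hj => ?_
  have hlt := h.lt j (Finset.ne_of_mem_erase hj)
  have hη : 0 ≤ 1 - lam 0 := h.etaV_nonneg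
  exact le_div_self (h.nonneg j) (by linarith) (by linarith [h.nonneg j])

theorem Evec_nonneg (h : IsDominated lam) : 0 ≤ Evec lam :=
  h.etaV_nonneg.trans h.etaV_le_Evec

theorem Evec_map_le (h : IsDominated lam) :
    Evec (Fmap lam) ≤ (1 + etaV lam) / 2 * Evec lam := by
  unfold Evec
  rw [Finset.mul_sum]
  refine Finset.sum_le_sum fun j hj => ?_
  have hj0 := Finset.ne_of_mem_erase hj
  have hsub : 0 < lam 0 - lam j := sub_pos.2 (h.lt j hj0)
  have hnn := h.nonneg j
  have hpos := h.pos
  have hle : lam j ≤ 1 - lam 0 := h.le_etaV hj0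
  have hratio : Fmap lam j / (Fmap lam 0 - Fmap lam j)
      = (1 + lam j) / (1 + lam 0 + lam j) * (lam j / (lam 0 - lam j)) := by
    have hS := (one_add_sum_sq_pos lam).ne'
    unfold Fmap
    rw [← sub_div, div_div_div_cancel_right₀ hS, div_mul_div_comm]
    congr 1 <;> ring
  rw [hratio]
  refine mul_le_mul_of_nonneg_right ?_ (div_nonneg hnn hsub.le)
  rw [div_le_iff₀ (by positivity)]
  unfold etaV
  nlinarith

theorem etaV_iterate_le (h : IsDominated lam) (hE : Evec lam ≤ 1 / 2) (t : ℕ) :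
    etaV (Fmap^[t] lam) ≤ Real.exp (4 * Evec lam) / 2 ^ t * Evec lam := by
  induction t generalizing lam with
  | zero =>
    have h1 : 1 ≤ Real.exp (4 * Evec lam) := Real.one_le_exp (by linarith [h.Evec_nonneg])
    simpa using h.etaV_le_Evec.trans (le_mul_of_one_le_left h.Evec_nonneg h1)
  | succ t ih =>
    have hE0 := h.Evec_nonneg
    have hη0 := h.etaV_nonneg
    have hηE := h.etaV_le_Evec
    have hstep := h.Evec_map_le
    have hcontr : Evec (Fmap lam) ≤ 3 / 4 * Evec lam := by nlinarith
    rw [Function.iterate_succ_apply]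
    calc etaV (Fmap^[t] (Fmap lam))
        ≤ Real.exp (4 * Evec (Fmap lam)) / 2 ^ t * Evec (Fmap lam) :=
          ih h.map (by linarith)
      _ ≤ Real.exp (4 * Evec (Fmap lam)) / 2 ^ t * (Real.exp (etaV lam) / 2 * Evec lam) := by
          gcongr
          refine hstep.trans ?_
          gcongr
          linarith [Real.add_one_le_exp (etaV lam)]
      _ = Real.exp (4 * Evec (Fmap lam) + etaV lam) / 2 ^ (t + 1) * Evec lam := by
          rw [Real.exp_add, pow_succ]
          field_simp
      _ ≤ Real.exp (4 * Evec lam) / 2 ^ (t + 1) * Evec lam := by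
          gcongr
          linarith

end IsDominated

/-- geometric decay of `η` in the third stage. -/
theorem stmt17 (d : ℕ) [NeZero d] (hd : 2 ≤ d) (lam : Fin d → ℝ) (hV : memV lam)
    (hE : Evec lam ≤ 1/2) (t : ℕ) :
    etaV (Fmap^[t] lam) ≤ Real.exp 2 / 2^t * Evec lam := by
  have h := hV.isDominated hd
  have hE0 := h.Evec_nonneg
  refine (h.etaV_iterate_le hE t).trans ?_
  gcongr
  linarith
end
end
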